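/- (Interpolation inequality on an annulus) Let n ≥ 1 and R > 1. There exists C = C(n) > 0 such that for every z ∈ W^{2,1}(B_{2R}), ∫_{B_R \ B_{R/2}} |Dz| ≤ C R ∫_{B_{2R} \ B_{R/4}} |Δz| + C R^{-1} ∫_{B_{2R} \ B_{R/4}} |z|. -/

import Mathlib

open MeasureTheory


/-- The Laplacian of a function on Euclidean space. -/
noncomputable def laplacian {n : ℕ} (z : EuclideanSpace ℝ (Fin n) → ℝ)
    (x : EuclideanSpace ℝ (Fin n)) : ℝ :=
  ∑ i : Fin n, iteratedFDeriv ℝ 2 z x ![EuclideanSpace.single i 1, EuclideanSpace.single i 1]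

lemma exists_eta (n : ℕ) : ∃ η : EuclideanSpace ℝ (Fin n) → ℝ, ContDiff ℝ 1 η ∧ HasCompactSupport η ∧
    (∀ y, 1 ≤ ‖y‖ → η y = 0) ∧ 0 < ∫ y, η y ∧
    (∀ (y : EuclideanSpace ℝ (Fin n)) (i j : Fin n),
      fderiv ℝ η y (EuclideanSpace.single i 1) * y j = fderiv ℝ η y (EuclideanSpace.single j 1) * y i) := by
  have hg : ContDiff ℝ 1 (fun s : ℝ => expNegInvGlue (1 - s)) :=
    expNegInvGlue.contDiff.comp (by fun_prop)
  have hη : ContDiff ℝ 1 (fun y : EuclideanSpace ℝ (Fin n) => expNegInvGlue (1 - ‖y‖ ^ 2)) :=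
    hg.comp (contDiff_norm_sq ℝ)
  have h0 : ∀ y : EuclideanSpace ℝ (Fin n), 1 ≤ ‖y‖ → expNegInvGlue (1 - ‖y‖ ^ 2) = 0 := by
    intro y hy
    apply expNegInvGlue.zero_of_nonpos
    nlinarith
  have hc : HasCompactSupport (fun y : EuclideanSpace ℝ (Fin n) => expNegInvGlue (1 - ‖y‖ ^ 2)) := by
    apply HasCompactSupport.of_support_subset_isCompact (isCompact_closedBall (0 : EuclideanSpace ℝ (Fin n)) 1)
    intro y hy
    by_contra h
    apply hy
    apply h0
    simp at h
    exact h.le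
  refine ⟨_, hη, hc, h0, ?_, ?_⟩
  · apply hη.continuous.integral_pos_of_hasCompactSupport_nonneg_nonzero hc (x := 0)
    · intro y; exact expNegInvGlue.nonneg _
    · simp
  · intro y i j
    have hd : HasFDerivAt (fun y : EuclideanSpace ℝ (Fin n) => expNegInvGlue (1 - ‖y‖ ^ 2))
        (deriv (fun s : ℝ => expNegInvGlue (1 - s)) (‖y‖ ^ 2) • (2 • (innerSL ℝ) y)) y := by
      have h1 := (hg.differentiable one_ne_zero (‖y‖ ^ 2)).hasDerivAt
      exact h1.comp_hasFDerivAt (f := fun y : EuclideanSpace ℝ (Fin n) => ‖y‖ ^ 2) y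
        (hasStrictFDerivAt_norm_sq y).hasFDerivAt
    rw [hd.fderiv]
    simp [EuclideanSpace.inner_single_right]
    ring

lemma hasFDerivAt_shift {n : ℕ} {w : EuclideanSpace ℝ (Fin n) → ℝ} (hw : ContDiff ℝ 1 w)
    (x : EuclideanSpace ℝ (Fin n)) (t : ℝ) (y : EuclideanSpace ℝ (Fin n)) :
    HasFDerivAt (fun y => w (x + t • y)) (t • fderiv ℝ w (x + t • y)) y := by
  have h1 := (hw.differentiable one_ne_zero (x + t • y)).hasFDerivAt
  have h2 : HasFDerivAt (fun y : EuclideanSpace ℝ (Fin n) => x + t • y)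
      (t • ContinuousLinearMap.id ℝ (EuclideanSpace ℝ (Fin n))) y :=
    ((hasFDerivAt_id y).const_smul t).const_add x
  have h3 := h1.comp y h2
  have h4 : (fderiv ℝ w (x + t • y)).comp (t • ContinuousLinearMap.id ℝ (EuclideanSpace ℝ (Fin n)))
      = t • fderiv ℝ w (x + t • y) := by
    ext v; simp
  rw [h4] at h3
  exact h3

lemma ibp {n : ℕ} {k w : EuclideanSpace ℝ (Fin n) → ℝ} (hk : ContDiff ℝ 1 k)
    (hc : HasCompactSupport k) (hw : ContDiff ℝ 1 w) (x : EuclideanSpace ℝ (Fin n)) {t : ℝ}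
    (ht : t ≠ 0) (v : EuclideanSpace ℝ (Fin n)) :
    ∫ y, k y * fderiv ℝ w (x + t • y) v = - t⁻¹ * ∫ y, fderiv ℝ k y v * w (x + t • y) := by
  have hwd := hw.continuous_fderiv one_ne_zero
  have hkd := hk.continuous_fderiv one_ne_zero
  have hkc := hk.continuous
  have hwc := hw.continuous
  have hcd : HasCompactSupport (fun y => fderiv ℝ k y v) := hc.fderiv_apply (𝕜 := ℝ) _
  have hd := hasFDerivAt_shift hw x t
  have e1 : ∀ y, fderiv ℝ (fun y => w (x + t • y)) y = t • fderiv ℝ w (x + t • y) :=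
    fun y => (hd y).fderiv
  have e := integral_mul_fderiv_eq_neg_fderiv_mul_of_integrable (μ := volume)
      (f := k) (g := fun y => w (x + t • y))
      (v := v) ?_ ?_ ?_ (fun y _ => hk.differentiable one_ne_zero y)
      (fun y _ => (hd y).differentiableAt)
  · simp only [e1] at e
    have e3 : ∫ y, k y * fderiv ℝ w (x + t • y) v =
         t⁻¹ * ∫ y, k y * (t • fderiv ℝ w (x + t • y)) v := by
      rw [← integral_const_mul]
      congr 1; ext y
      simp only [_root_.smul_apply, smul_eq_mul]
      field_simp
    rw [e3, e, neg_mul, mul_neg]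
  · apply Continuous.integrable_of_hasCompactSupport
    · fun_prop
    · exact hcd.mul_right
  · simp only [e1]
    apply Continuous.integrable_of_hasCompactSupport
    · simp only [_root_.smul_apply]; fun_prop
    · exact hc.mul_right
  · apply Continuous.integrable_of_hasCompactSupport
    · fun_prop
    · exact hc.mul_right

lemma swap_dir {n : ℕ} {η w : EuclideanSpace ℝ (Fin n) → ℝ} (hη : ContDiff ℝ 1 η)
    (hc : HasCompactSupport η)
    (hs : ∀ (y : EuclideanSpace ℝ (Fin n)) (i j : Fin n),
      fderiv ℝ η y (EuclideanSpace.single i 1) * y j = fderiv ℝ η y (EuclideanSpace.single j 1) * y i)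
    (hw : ContDiff ℝ 1 w) (x : EuclideanSpace ℝ (Fin n)) {t : ℝ} (ht : t ≠ 0) (i j : Fin n) :
    ∫ y, η y * y j * fderiv ℝ w (x + t • y) (EuclideanSpace.single i 1) =
    ∫ y, η y * y i * fderiv ℝ w (x + t • y) (EuclideanSpace.single j 1) := by
  have hk : ∀ j : Fin n, ContDiff ℝ 1 (fun y : EuclideanSpace ℝ (Fin n) => η y * y j) := fun j =>
    hη.mul (EuclideanSpace.proj j : EuclideanSpace ℝ (Fin n) →L[ℝ] ℝ).contDiff
  have hkc : ∀ j : Fin n, HasCompactSupport (fun y : EuclideanSpace ℝ (Fin n) => η y * y j) :=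
    fun j => hc.mul_right
  have hf : ∀ (j : Fin n) (y : EuclideanSpace ℝ (Fin n)),
      fderiv ℝ (fun y : EuclideanSpace ℝ (Fin n) => η y * y j) y =
        (η y • (EuclideanSpace.proj j : EuclideanSpace ℝ (Fin n) →L[ℝ] ℝ) + y j • fderiv ℝ η y) :=
    fun j y => ((hη.differentiable one_ne_zero y).hasFDerivAt.mul
        (EuclideanSpace.proj j : EuclideanSpace ℝ (Fin n) →L[ℝ] ℝ).hasFDerivAt).fderiv
  rw [ibp (hk j) (hkc j) hw x ht, ibp (hk i) (hkc i) hw x ht]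
  congr 2
  ext y
  rw [hf, hf]
  congr 1
  have := hs y i j
  have hp : (EuclideanSpace.proj j : EuclideanSpace ℝ (Fin n) →L[ℝ] ℝ) (EuclideanSpace.single i 1)
      = (EuclideanSpace.proj i : EuclideanSpace ℝ (Fin n) →L[ℝ] ℝ) (EuclideanSpace.single j 1) := by
    simp [eq_comm]
  simp only [_root_.add_apply, _root_.smul_apply, smul_eq_mul]
  rw [mul_comm (y j), mul_comm (y i), this, hp]

lemma contDiff_p {n : ℕ} {z : EuclideanSpace ℝ (Fin n) → ℝ} (hz : ContDiff ℝ 2 z)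
    (v : EuclideanSpace ℝ (Fin n)) : ContDiff ℝ 1 (fun x => fderiv ℝ z x v) :=
  (hz.fderiv_right (m := 1) (by norm_num)).clm_apply contDiff_const

lemma fderiv_p {n : ℕ} {z : EuclideanSpace ℝ (Fin n) → ℝ} (hz : ContDiff ℝ 2 z)
    (v x u : EuclideanSpace ℝ (Fin n)) :
    fderiv ℝ (fun x => fderiv ℝ z x v) x u = fderiv ℝ (fderiv ℝ z) x u v := by
  have h : DifferentiableAt ℝ (fderiv ℝ z) x :=
    (hz.fderiv_right (m := 1) (by norm_num)).differentiable one_ne_zero x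
  rw [fderiv_clm_apply h (differentiableAt_const v)]
  simp

lemma fderiv_p_symm {n : ℕ} {z : EuclideanSpace ℝ (Fin n) → ℝ} (hz : ContDiff ℝ 2 z)
    (v x u : EuclideanSpace ℝ (Fin n)) :
    fderiv ℝ (fun x => fderiv ℝ z x v) x u = fderiv ℝ (fun x => fderiv ℝ z x u) x v := by
  rw [fderiv_p hz, fderiv_p hz]
  exact (hz.contDiffAt.isSymmSndFDerivAt (by simp)) u v

lemma laplacian_eq {n : ℕ} {z : EuclideanSpace ℝ (Fin n) → ℝ} (hz : ContDiff ℝ 2 z)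
    (x : EuclideanSpace ℝ (Fin n)) :
    laplacian z x = ∑ j : Fin n, fderiv ℝ (fun x => fderiv ℝ z x (EuclideanSpace.single j 1)) x
      (EuclideanSpace.single j 1) := by
  simp only [laplacian, iteratedFDeriv_two_apply, fderiv_p hz]
  rfl

lemma laplacian_cont {n : ℕ} {z : EuclideanSpace ℝ (Fin n) → ℝ} (hz : ContDiff ℝ 2 z) :
    Continuous (laplacian z) := by
  have : laplacian z = fun x => ∑ j : Fin n,
      fderiv ℝ (fun x => fderiv ℝ z x (EuclideanSpace.single j 1)) x
      (EuclideanSpace.single j 1) := funext (laplacian_eq hz)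
  rw [this]
  refine continuous_finsetSum _ fun j _ => ?_
  exact ((contDiff_p hz _).continuous_fderiv one_ne_zero).clm_apply continuous_const

lemma lap_step {n : ℕ} {η z : EuclideanSpace ℝ (Fin n) → ℝ} (hη : ContDiff ℝ 1 η)
    (hc : HasCompactSupport η)
    (hs : ∀ (y : EuclideanSpace ℝ (Fin n)) (i j : Fin n),
      fderiv ℝ η y (EuclideanSpace.single i 1) * y j = fderiv ℝ η y (EuclideanSpace.single j 1) * y i)
    (hz : ContDiff ℝ 2 z) (x : EuclideanSpace ℝ (Fin n)) {t : ℝ} (ht : t ≠ 0) (i : Fin n) :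
    ∫ y, η y * fderiv ℝ (fun x => fderiv ℝ z x (EuclideanSpace.single i 1)) (x + t • y) y =
    ∫ y, η y * y i * laplacian z (x + t • y) := by
  have hηc := hη.continuous
  have hint : ∀ i j k : Fin n, Integrable (fun y : EuclideanSpace ℝ (Fin n) => η y * y k *
      fderiv ℝ (fun x => fderiv ℝ z x (EuclideanSpace.single j 1)) (x + t • y)
        (EuclideanSpace.single i 1)) := by
    intro i j k
    have h1 := (contDiff_p hz (EuclideanSpace.single j 1)).continuous_fderiv one_ne_zero
    apply Continuous.integrable_of_hasCompactSupport
    · fun_prop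
    · exact hc.mul_right.mul_right
  calc _ = ∫ y, ∑ j, η y * y j * fderiv ℝ (fun x => fderiv ℝ z x (EuclideanSpace.single j 1))
          (x + t • y) (EuclideanSpace.single i 1) := by
        congr 1; ext y
        have hy : y = ∑ j, y j • (EuclideanSpace.single j 1 : EuclideanSpace ℝ (Fin n)) := by
          ext k
          simp [Finset.sum_apply, Pi.single_apply]
        have h2 : ∀ q, fderiv ℝ (fun x => fderiv ℝ z x (EuclideanSpace.single i 1)) q y
            = ∑ j, y j * fderiv ℝ (fun x => fderiv ℝ z x (EuclideanSpace.single j 1))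
          q (EuclideanSpace.single i 1) := by
          intro q
          conv_lhs => rw [hy]
          rw [map_sum]
          refine Finset.sum_congr rfl fun j _ => ?_
          rw [map_smul, smul_eq_mul, fderiv_p_symm hz]
        rw [h2, Finset.mul_sum]
        refine Finset.sum_congr rfl fun j _ => ?_
        ring
    _ = ∑ j, ∫ y, η y * y j * fderiv ℝ (fun x => fderiv ℝ z x (EuclideanSpace.single j 1))
          (x + t • y) (EuclideanSpace.single i 1) := integral_finsetSum _ fun j _ => hint _ _ _
    _ = ∑ j, ∫ y, η y * y i * fderiv ℝ (fun x => fderiv ℝ z x (EuclideanSpace.single j 1))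
          (x + t • y) (EuclideanSpace.single j 1) := by
        refine Finset.sum_congr rfl fun j _ => ?_
        exact swap_dir hη hc hs (contDiff_p hz _) x ht i j
    _ = _ := by
        rw [← integral_finsetSum _ fun j _ => hint _ _ _]
        simp only [laplacian_eq hz, Finset.mul_sum]

lemma repr_formula {n : ℕ} {η z : EuclideanSpace ℝ (Fin n) → ℝ} (hη : ContDiff ℝ 1 η)
    (hc : HasCompactSupport η)
    (hs : ∀ (y : EuclideanSpace ℝ (Fin n)) (i j : Fin n),
      fderiv ℝ η y (EuclideanSpace.single i 1) * y j = fderiv ℝ η y (EuclideanSpace.single j 1) * y i)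
    (hz : ContDiff ℝ 2 z) (x : EuclideanSpace ℝ (Fin n)) {r : ℝ} (hr : 0 < r) (i : Fin n) :
    (∫ y, η y) * fderiv ℝ z x (EuclideanSpace.single i 1) =
      - r⁻¹ * (∫ y, fderiv ℝ η y (EuclideanSpace.single i 1) * z (x + r • y)) -
      ∫ t in Set.Ioc 0 r, ∫ y, η y * y i * laplacian z (x + t • y) := by
  have hηc := hη.continuous
  set p := fun x => fderiv ℝ z x (EuclideanSpace.single i 1) with hp
  have hpC : ContDiff ℝ 1 p := contDiff_p hz _
  have hpc := hpC.continuous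
  have hpd := hpC.continuous_fderiv one_ne_zero
  have e1 : ∀ y, ∫ t in (0:ℝ)..r, η y * fderiv ℝ p (x + t • y) y = η y * (p (x + r • y) - p x) := by
    intro y
    rw [intervalIntegral.integral_const_mul]
    congr 1
    have := intervalIntegral.integral_eq_sub_of_hasDerivAt (a := 0) (b := r)
      (f := fun t : ℝ => p (x + t • y)) (f' := fun t => fderiv ℝ p (x + t • y) y) ?_ ?_
    · simpa using this
    · intro t _
      have h1 := (hpC.differentiable one_ne_zero (x + t • y)).hasFDerivAt
      have h2 : HasDerivAt (fun t : ℝ => x + t • y) y t := by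
        simpa using ((hasDerivAt_id t).smul_const y).const_add x
      exact h1.comp_hasDerivAt t h2
    · apply Continuous.intervalIntegrable
      fun_prop
  have e2 : ∫ t in (0:ℝ)..r, ∫ y, η y * fderiv ℝ p (x + t • y) y =
      ∫ y, ∫ t in (0:ℝ)..r, η y * fderiv ℝ p (x + t • y) y := by
    apply intervalIntegral_integral_swap
    rw [Set.uIoc_of_le hr.le]
    have hcont : Continuous (Function.uncurry fun (t : ℝ) y => η y * fderiv ℝ p (x + t • y) y) := by
      simp only [Function.uncurry_def]
      fun_prop
    have h1 : IntegrableOn (Function.uncurry fun (t : ℝ) y => η y * fderiv ℝ p (x + t • y) y)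
        (Set.Icc 0 r ×ˢ tsupport η) (volume.prod volume) :=
      hcont.continuousOn.integrableOn_compact (isCompact_Icc.prod hc)
    have h2 : IntegrableOn (Function.uncurry fun (t : ℝ) y => η y * fderiv ℝ p (x + t • y) y)
        (Set.Icc 0 r ×ˢ Set.univ) (volume.prod volume) := by
      refine h1.of_forall_sdiff_eq_zero (measurableSet_Icc.prod MeasurableSet.univ) ?_
      rintro ⟨t, y⟩ ⟨⟨ht, _⟩, hn⟩
      have : η y = 0 := by
        apply image_eq_zero_of_notMem_tsupport
        intro h
        exact hn ⟨ht, h⟩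
      simp [Function.uncurry, this]
    have h3 := h2.mono_set (Set.prod_mono_left (Set.Ioc_subset_Icc_self))
    rw [IntegrableOn, ← Measure.prod_restrict, Measure.restrict_univ] at h3
    exact h3
  have e3 : ∫ t in Set.Ioc 0 r, ∫ y, η y * y i * laplacian z (x + t • y) =
      ∫ t in (0:ℝ)..r, ∫ y, η y * fderiv ℝ p (x + t • y) y := by
    rw [intervalIntegral.integral_of_le hr.le]
    refine setIntegral_congr_fun measurableSet_Ioc fun t ht => ?_
    exact (lap_step hη hc hs hz x ht.1.ne' i).symm
  rw [e3, e2]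
  simp only [e1, mul_sub]
  rw [integral_sub, integral_mul_const, ibp hη hc (hz.of_le (by norm_num)) x hr.ne'
    (EuclideanSpace.single i 1) |>.symm]
  · ring
  · apply Continuous.integrable_of_hasCompactSupport
    · fun_prop
    · exact hc.mul_right
  · apply Continuous.integrable_of_hasCompactSupport
    · fun_prop
    · exact hc.mul_right

lemma tonelli_bound {n : ℕ} {k f : EuclideanSpace ℝ (Fin n) → ℝ} (hk : Continuous k)
    (hk0 : ∀ y, 1 < ‖y‖ → k y = 0) (hf : Continuous f) {A B : Set (EuclideanSpace ℝ (Fin n))}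
    (hA : MeasurableSet A) (hB : MeasurableSet B) (t : ℝ)
    (hAB : ∀ x ∈ A, ∀ y : EuclideanSpace ℝ (Fin n), ‖y‖ ≤ 1 → x + t • y ∈ B) :
    ∫⁻ x in A, ∫⁻ y, ‖k y‖ₑ * ‖f (x + t • y)‖ₑ ≤ (∫⁻ y, ‖k y‖ₑ) * ∫⁻ x in B, ‖f x‖ₑ := by
  rw [lintegral_lintegral_swap]
  · rw [← lintegral_mul_const _ (by fun_prop)]
    refine lintegral_mono fun y => ?_
    rw [lintegral_const_mul _ (by have := hf.measurable; fun_prop)]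
    by_cases hy : ‖y‖ ≤ 1
    · refine mul_le_mul_right ?_ _
      rw [← lintegral_indicator hA, ← lintegral_indicator hB,
        ← lintegral_add_right_eq_self (B.indicator fun x => ‖f x‖ₑ) (t • y)]
      refine lintegral_mono fun x => ?_
      by_cases hx : x ∈ A
      · rw [Set.indicator_of_mem hx, Set.indicator_of_mem (hAB x hx y hy)]
      · rw [Set.indicator_of_notMem hx]
        exact zero_le
    · rw [hk0 y (not_le.mp hy)]
      simp
  · apply Measurable.aemeasurable
    simp only [Function.uncurry_def]
    fun_prop

lemma coord_bound {n : ℕ} {η z : EuclideanSpace ℝ (Fin n) → ℝ} (hη : ContDiff ℝ 1 η)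
    (hc : HasCompactSupport η) (h0 : ∀ y, 1 ≤ ‖y‖ → η y = 0)
    (hs : ∀ (y : EuclideanSpace ℝ (Fin n)) (i j : Fin n),
      fderiv ℝ η y (EuclideanSpace.single i 1) * y j = fderiv ℝ η y (EuclideanSpace.single j 1) * y i)
    (hz : ContDiff ℝ 2 z) {r : ℝ} (hr : 0 < r) (i : Fin n)
    {A B : Set (EuclideanSpace ℝ (Fin n))}
    (hA : MeasurableSet A) (hB : MeasurableSet B)
    (hAB : ∀ t, 0 < t → t ≤ r → ∀ x ∈ A, ∀ y : EuclideanSpace ℝ (Fin n), ‖y‖ ≤ 1 → x + t • y ∈ B) :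
    ‖∫ y, η y‖ₑ * ∫⁻ x in A, ‖fderiv ℝ z x (EuclideanSpace.single i 1)‖ₑ ≤
      ‖r⁻¹‖ₑ * ((∫⁻ y, ‖fderiv ℝ η y (EuclideanSpace.single i 1)‖ₑ) * ∫⁻ x in B, ‖z x‖ₑ) +
      ENNReal.ofReal r * ((∫⁻ y, ‖η y * y i‖ₑ) * ∫⁻ x in B, ‖laplacian z x‖ₑ) := by
  have hηc := hη.continuous
  have hηd := hη.continuous_fderiv one_ne_zero
  have hzd := hz.continuous_fderiv two_ne_zero
  have hzc := hz.continuous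
  have hlc := laplacian_cont hz
  have hts : tsupport η ⊆ Metric.closedBall 0 1 := by
    apply closure_minimal _ Metric.isClosed_closedBall
    intro y hy
    by_contra h
    apply hy
    apply h0
    simp at h
    exact h.le
  have hk1 : ∀ y, 1 < ‖y‖ → fderiv ℝ η y (EuclideanSpace.single i 1) = 0 := by
    intro y hy
    have : fderiv ℝ η y = 0 := by
      by_contra h
      have h1 := hts (support_fderiv_subset ℝ (f := η) h)
      simp at h1
      linarith
    rw [this]; simp
  have hk2 : ∀ y : EuclideanSpace ℝ (Fin n), 1 < ‖y‖ → η y * y i = 0 := by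
    intro y hy
    rw [h0 y hy.le, zero_mul]
  have hmeas : Measurable (Function.uncurry fun (x : EuclideanSpace ℝ (Fin n)) (t : ℝ) =>
      ∫⁻ y, ‖η y * y i‖ₑ * ‖laplacian z (x + t • y)‖ₑ) := by
    apply Measurable.lintegral_prod_right' (f := fun q : (EuclideanSpace ℝ (Fin n) × ℝ) ×
      EuclideanSpace ℝ (Fin n) => ‖η q.2 * q.2 i‖ₑ * ‖laplacian z (q.1.1 + q.1.2 • q.2)‖ₑ)
    fun_prop
  have hpt : ∀ x, ‖∫ y, η y‖ₑ * ‖fderiv ℝ z x (EuclideanSpace.single i 1)‖ₑ ≤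
      ‖r⁻¹‖ₑ * (∫⁻ y, ‖fderiv ℝ η y (EuclideanSpace.single i 1)‖ₑ * ‖z (x + r • y)‖ₑ) +
      ∫⁻ t in Set.Ioc 0 r, ∫⁻ y, ‖η y * y i‖ₑ * ‖laplacian z (x + t • y)‖ₑ := by
    intro x
    rw [← enorm_mul, repr_formula hη hc hs hz x hr i]
    refine enorm_sub_le.trans (add_le_add ?_ ?_)
    · rw [enorm_mul, enorm_neg]
      refine mul_le_mul_right ?_ _
      refine (enorm_integral_le_lintegral_enorm _).trans (le_of_eq ?_)
      simp only [enorm_mul]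
    · refine (enorm_integral_le_lintegral_enorm _).trans (lintegral_mono fun t => ?_)
      refine (enorm_integral_le_lintegral_enorm _).trans (le_of_eq ?_)
      simp only [enorm_mul]
  rw [← lintegral_const_mul _ (by fun_prop)]
  refine (lintegral_mono hpt).trans ?_
  rw [lintegral_add_right _ hmeas.lintegral_prod_right]
  refine add_le_add ?_ ?_
  · rw [lintegral_const_mul']
    · refine mul_le_mul_right ?_ _
      exact tonelli_bound (by fun_prop) hk1 hzc hA hB r (hAB r hr le_rfl)
    · exact enorm_ne_top
  · rw [lintegral_lintegral_swap hmeas.aemeasurable]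
    calc _ ≤ ∫⁻ t in Set.Ioc 0 r, ((∫⁻ y, ‖η y * y i‖ₑ) * ∫⁻ x in B, ‖laplacian z x‖ₑ) := by
          refine setLIntegral_mono' measurableSet_Ioc fun t ht => ?_
          exact tonelli_bound (by fun_prop) hk2 hlc hA hB t (hAB t ht.1 ht.2)
      _ = _ := by
          rw [setLIntegral_const, Real.volume_Ioc, sub_zero, mul_comm]

lemma norm_le_sum {n : ℕ} (L : EuclideanSpace ℝ (Fin n) →L[ℝ] ℝ) :
    ‖L‖ ≤ ∑ i, |L (EuclideanSpace.single i 1)| := by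
  refine L.opNorm_le_bound (Finset.sum_nonneg fun _ _ => abs_nonneg _) fun y => ?_
  have hy : y = ∑ j, y j • (EuclideanSpace.single j 1 : EuclideanSpace ℝ (Fin n)) := by
    ext k
    simp [Finset.sum_apply, Pi.single_apply]
  conv_lhs => rw [hy]
  rw [map_sum, Finset.sum_mul]
  refine (norm_sum_le _ _).trans (Finset.sum_le_sum fun j _ => ?_)
  rw [map_smul, norm_smul, mul_comm]
  exact mul_le_mul_of_nonneg_left (PiLp.norm_apply_le y j) (norm_nonneg _)

lemma coord_bound_real {n : ℕ} {η z : EuclideanSpace ℝ (Fin n) → ℝ} (hη : ContDiff ℝ 1 η)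
    (hc : HasCompactSupport η) (h0 : ∀ y, 1 ≤ ‖y‖ → η y = 0) (hpos : 0 < ∫ y, η y)
    (hs : ∀ (y : EuclideanSpace ℝ (Fin n)) (i j : Fin n),
      fderiv ℝ η y (EuclideanSpace.single i 1) * y j = fderiv ℝ η y (EuclideanSpace.single j 1) * y i)
    (hz : ContDiff ℝ 2 z) {r : ℝ} (hr : 0 < r) (i : Fin n)
    {A B : Set (EuclideanSpace ℝ (Fin n))}
    (hA : MeasurableSet A) (hB : MeasurableSet B) (hBb : Bornology.IsBounded B)
    (hAB : ∀ t, 0 < t → t ≤ r → ∀ x ∈ A, ∀ y : EuclideanSpace ℝ (Fin n), ‖y‖ ≤ 1 → x + t • y ∈ B) :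
    (∫ y, η y) * ∫ x in A, |fderiv ℝ z x (EuclideanSpace.single i 1)| ≤
      r⁻¹ * ((∫ y, |fderiv ℝ η y (EuclideanSpace.single i 1)|) * ∫ x in B, |z x|) +
      r * ((∫ y, |η y * y i|) * ∫ x in B, |laplacian z x|) := by
  have hηc := hη.continuous
  have hηd := hη.continuous_fderiv one_ne_zero
  have hzd := hz.continuous_fderiv two_ne_zero
  have hzc := hz.continuous
  have hlc := laplacian_cont hz
  have key := coord_bound hη hc h0 hs hz hr i hA hB hAB
  have hfin : ∀ f : EuclideanSpace ℝ (Fin n) → ℝ, Continuous f → IntegrableOn f B := fun f hf =>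
    (hf.continuousOn.integrableOn_compact hBb.isCompact_closure).mono_set subset_closure
  have i1 : Integrable (fun y => fderiv ℝ η y (EuclideanSpace.single i 1)) :=
    Continuous.integrable_of_hasCompactSupport (by fun_prop) (hc.fderiv_apply (𝕜 := ℝ) _)
  have i2 : Integrable (fun y : EuclideanSpace ℝ (Fin n) => η y * y i) :=
    Continuous.integrable_of_hasCompactSupport (by fun_prop) hc.mul_right
  simp only [← Real.norm_eq_abs]
  rw [integral_norm_eq_lintegral_enorm (by fun_prop),
    integral_norm_eq_lintegral_enorm (by fun_prop),
    integral_norm_eq_lintegral_enorm (by fun_prop),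
    integral_norm_eq_lintegral_enorm (by fun_prop),
    integral_norm_eq_lintegral_enorm (by fun_prop)]
  have f1 := i1.hasFiniteIntegral.ne
  have f2 := i2.hasFiniteIntegral.ne
  have f3 := (hfin z hzc).hasFiniteIntegral.ne
  have f4 := (hfin _ hlc).hasFiniteIntegral.ne
  have t1 : ‖r⁻¹‖ₑ * ((∫⁻ y, ‖fderiv ℝ η y (EuclideanSpace.single i 1)‖ₑ) * ∫⁻ x in B, ‖z x‖ₑ) ≠ ⊤ :=
    ENNReal.mul_ne_top enorm_ne_top (ENNReal.mul_ne_top f1 f3)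
  have t2 : ENNReal.ofReal r * ((∫⁻ y, ‖η y * y i‖ₑ) * ∫⁻ x in B, ‖laplacian z x‖ₑ) ≠ ⊤ :=
    ENNReal.mul_ne_top ENNReal.ofReal_ne_top (ENNReal.mul_ne_top f2 f4)
  have := ENNReal.toReal_mono (ENNReal.add_ne_top.2 ⟨t1, t2⟩) key
  rw [ENNReal.toReal_add t1 t2] at this
  simp only [ENNReal.toReal_mul, toReal_enorm, ENNReal.toReal_ofReal hr.le, Real.norm_eq_abs,
    abs_of_pos hpos, abs_of_pos (inv_pos.2 hr)] at this
  exact this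

/-- Interpolation inequality on an annulus: there is C = C(n) such that for all R > 1
and all W^{2,1} functions z,
∫_{B_R \ B_{R/2}} |Dz| ≤ C R ∫_{B_{2R} \ B_{R/4}} |Δz| + C R⁻¹ ∫_{B_{2R} \ B_{R/4}} |z|. -/
theorem interpolation_on_annulus (n : ℕ) (hn : 1 ≤ n) :
    ∃ C > 0, ∀ R > (1 : ℝ), ∀ z : EuclideanSpace ℝ (Fin n) → ℝ, ContDiff ℝ 2 z →
      ∫ x in Metric.ball (0 : EuclideanSpace ℝ (Fin n)) R \
          Metric.ball (0 : EuclideanSpace ℝ (Fin n)) (R / 2), ‖fderiv ℝ z x‖ ≤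
        C * R * (∫ x in Metric.ball (0 : EuclideanSpace ℝ (Fin n)) (2 * R) \
            Metric.ball (0 : EuclideanSpace ℝ (Fin n)) (R / 4), |laplacian z x|) +
        C * R⁻¹ * (∫ x in Metric.ball (0 : EuclideanSpace ℝ (Fin n)) (2 * R) \
            Metric.ball (0 : EuclideanSpace ℝ (Fin n)) (R / 4), |z x|) := by
  obtain ⟨η, hη, hc, h0, hpos, hs⟩ := exists_eta n
  set c := ∫ y, η y with hcdef
  set K : ℝ := ∑ i : Fin n, (∫ y, |fderiv ℝ η y (EuclideanSpace.single i 1)|) with hK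
  set M : ℝ := ∑ i : Fin n, (∫ y : EuclideanSpace ℝ (Fin n), |η y * y i|) with hM
  have hK0 : 0 ≤ K := Finset.sum_nonneg fun _ _ => integral_nonneg fun _ => abs_nonneg _
  have hM0 : 0 ≤ M := Finset.sum_nonneg fun _ _ => integral_nonneg fun _ => abs_nonneg _
  refine ⟨(4 * K + M + 1) / c, by positivity, ?_⟩
  intro R hR z hz
  set A := Metric.ball (0 : EuclideanSpace ℝ (Fin n)) R \
          Metric.ball (0 : EuclideanSpace ℝ (Fin n)) (R / 2) with hAdef
  set B := Metric.ball (0 : EuclideanSpace ℝ (Fin n)) (2 * R) \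
            Metric.ball (0 : EuclideanSpace ℝ (Fin n)) (R / 4) with hBdef
  have hA : MeasurableSet A := measurableSet_ball.diff measurableSet_ball
  have hB : MeasurableSet B := measurableSet_ball.diff measurableSet_ball
  have hAb : Bornology.IsBounded A := Metric.isBounded_ball.subset Set.sdiff_subset
  have hBb : Bornology.IsBounded B := Metric.isBounded_ball.subset Set.sdiff_subset
  have hR0 : 0 < R := by linarith
  have hAB : ∀ t, 0 < t → t ≤ R / 4 → ∀ x ∈ A, ∀ y : EuclideanSpace ℝ (Fin n), ‖y‖ ≤ 1 →
      x + t • y ∈ B := by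
    intro t ht htr x hx y hy
    simp only [hAdef, hBdef, Set.mem_sdiff, mem_ball_zero_iff, not_lt] at hx ⊢
    have h1 : ‖t • y‖ ≤ R / 4 := by
      rw [norm_smul, Real.norm_eq_abs, abs_of_pos ht]
      nlinarith [norm_nonneg y]
    have h2 := norm_add_le x (t • y)
    have h3 := norm_sub_le (x + t • y) (t • y)
    rw [add_sub_cancel_right] at h3
    constructor <;> linarith
  have hzd := hz.continuous_fderiv two_ne_zero
  have hfin : ∀ f : EuclideanSpace ℝ (Fin n) → ℝ, Continuous f → IntegrableOn f A := fun f hf =>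
    (hf.continuousOn.integrableOn_compact hAb.isCompact_closure).mono_set subset_closure
  have s1 : ∫ x in A, ‖fderiv ℝ z x‖ ≤
      ∑ i, ∫ x in A, |fderiv ℝ z x (EuclideanSpace.single i 1)| := by
    rw [← integral_finsetSum _ (fun i _ => hfin _ (by fun_prop))]
    exact integral_mono (hfin _ (by fun_prop)) (hfin _ (by fun_prop)) fun x => norm_le_sum _
  set Z := ∫ x in B, |z x|
  set W := ∫ x in B, |laplacian z x|
  have hZ : 0 ≤ Z := integral_nonneg fun _ => abs_nonneg _
  have hW : 0 ≤ W := integral_nonneg fun _ => abs_nonneg _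
  have s2 : c * ∑ i, ∫ x in A, |fderiv ℝ z x (EuclideanSpace.single i 1)| ≤
      (R / 4)⁻¹ * (K * Z) + (R / 4) * (M * W) := by
    rw [hK, hM, Finset.mul_sum, Finset.sum_mul, Finset.sum_mul, Finset.mul_sum, Finset.mul_sum,
      ← Finset.sum_add_distrib]
    exact Finset.sum_le_sum fun i _ =>
      coord_bound_real hη hc h0 hpos hs hz (by positivity) i hA hB hBb hAB
  have s3 : c * ∫ x in A, ‖fderiv ℝ z x‖ ≤ (R / 4)⁻¹ * (K * Z) + (R / 4) * (M * W) :=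
    (mul_le_mul_of_nonneg_left s1 hpos.le).trans s2
  have s4 : (R / 4)⁻¹ * (K * Z) + (R / 4) * (M * W) ≤
      (4 * K + M + 1) * R * W + (4 * K + M + 1) * R⁻¹ * Z := by
    have e : (R / 4)⁻¹ = 4 * R⁻¹ := by field_simp
    have a1 : 0 ≤ R * W := by positivity
    have a2 : 0 ≤ R⁻¹ * Z := by positivity
    rw [e]
    nlinarith [mul_nonneg hK0 a1, mul_nonneg hM0 a1, mul_nonneg hK0 a2, mul_nonneg hM0 a2]
  have s5 : (4 * K + M + 1) / c * R * W + (4 * K + M + 1) / c * R⁻¹ * Z =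
      ((4 * K + M + 1) * R * W + (4 * K + M + 1) * R⁻¹ * Z) / c := by
    ring
  rw [s5, le_div_iff₀ hpos, mul_comm]
  exact s3.trans s4
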